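/- Let T be a positive integer and let j₁, j₂ be integers with 0 ≤ j₁, j₂ ≤ T−1. Let z be a rational number of the form (an integer)/T, let x be a rational number with x + j₂/T an integer, and let q₁ be a rational number with q₁ − j₁/T an integer. Let j₃ᵛ be the residue of −(j₁ + j₂) modulo T. Then, as rational numbers, λ(z + x, j₃ᵛ) − x + q₁ = ⌊z + q₁⌋. -/

import Mathlib

/-- `δ_i(j) = 1` if `i ≥ j` and `0` otherwise, for integers `i, j` (valued in `ℚ`). -/
def qdelta (i j : ℤ) : ℚ := if j ≤ i then 1 else 0

/-- For a rational `y` of the form `b/T`, the residue `ỹ` of `Ty = b` modulo `T`,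
so that `0 ≤ ỹ < T` and `y = ⌊y⌋ + ỹ/T`. -/
def til (T : ℕ) (y : ℚ) : ℤ := ⌊(T : ℚ) * y⌋ % (T : ℤ)

/-- `λ(y, r) = −1 + ⌊y⌋ + δ_{ỹ}(r) + r/T`. -/
def lam (T : ℕ) (y : ℚ) (r : ℤ) : ℚ :=
  -1 + (⌊y⌋ : ℚ) + qdelta (til T y) r + (r : ℚ) / (T : ℚ)

theorem til_intCast_div (T : ℕ) (hT : 0 < T) (n : ℤ) : til T ((n : ℚ) / (T : ℚ)) = n % (T : ℤ) := by
  have hT' : (T : ℚ) ≠ 0 := by exact_mod_cast hT.ne'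
  rw [til, mul_div_cancel₀ _ hT', Int.floor_intCast]

/-- For `0 ≤ r < T`, the `δ`-correction in `λ(n/T, r)` turns `⌊n/T⌋ - 1` into `⌊(n - r)/T⌋`. -/
theorem lam_intCast_div (T : ℕ) (n r : ℤ) (hr : 0 ≤ r) (hrT : r < T) :
    lam T ((n : ℚ) / (T : ℚ)) r = (((n - r) / (T : ℤ) : ℤ) : ℚ) + (r : ℚ) / (T : ℚ) := by
  have hT : (0 : ℤ) < T := hr.trans_lt hrT
  have hn := Int.emod_add_mul_ediv n T
  have hn₀ := Int.emod_nonneg n hT.ne'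
  have hn₁ := Int.emod_lt_of_pos n hT
  rw [lam, til_intCast_div T (by exact_mod_cast hT), Rat.floor_intCast_div_natCast, qdelta]
  split_ifs with h
  · have hdiv : (n - r) / (T : ℤ) = n / T := by
      rw [Int.ediv_eq_iff_of_pos hT]
      constructor <;> linarith
    rw [hdiv]
    ring
  · have hdiv : (n - r) / (T : ℤ) = n / T - 1 := by
      rw [Int.ediv_eq_iff_of_pos hT]
      constructor <;> linarith
    rw [hdiv]
    push_cast
    ring

/-- Lemma A.4: with `z = a/T`, `x + j₂/T ∈ ℤ`, `q₁ − j₁/T ∈ ℤ`,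
`0 ≤ j₁, j₂ ≤ T−1` and `j₃ᵛ = (−(j₁+j₂)) mod T`, one has
`λ(z + x, j₃ᵛ) − x + q₁ = ⌊z + q₁⌋`. -/
theorem stmt7 (T : ℕ) (hT : 0 < T) (j₁ j₂ : ℤ)
    (hj₁ : 0 ≤ j₁) (hj₁' : j₁ ≤ (T : ℤ) - 1)
    (hj₂ : 0 ≤ j₂) (hj₂' : j₂ ≤ (T : ℤ) - 1)
    (a : ℤ) (x q₁ : ℚ)
    (hx : ∃ b : ℤ, x + (j₂ : ℚ) / (T : ℚ) = (b : ℚ))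
    (hq₁ : ∃ c : ℤ, q₁ - (j₁ : ℚ) / (T : ℚ) = (c : ℚ)) :
    lam T ((a : ℚ) / (T : ℚ) + x) ((-(j₁ + j₂)) % (T : ℤ)) - x + q₁
      = (⌊(a : ℚ) / (T : ℚ) + q₁⌋ : ℚ) := by
  obtain ⟨b, hb⟩ := hx
  obtain ⟨c, hc⟩ := hq₁
  have hT₀ : (T : ℚ) ≠ 0 := by exact_mod_cast hT.ne'
  have hTz : (0 : ℤ) < T := by exact_mod_cast hT
  set r := (-(j₁ + j₂)) % (T : ℤ)
  set k := (-(j₁ + j₂)) / (T : ℤ)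
  have hrk : r + T * k = -(j₁ + j₂) := Int.emod_add_mul_ediv _ _
  have hrkQ : (r : ℚ) + T * k = -(j₁ + j₂) := by exact_mod_cast hrk
  obtain rfl : x = b - j₂ / T := by linarith
  obtain rfl : q₁ = c + j₁ / T := by linarith
  have hy : (a : ℚ) / T + (b - j₂ / T) = ((a - j₂ + b * T : ℤ) : ℚ) / T := by
    push_cast
    field_simp
    ring
  have hz : (a : ℚ) / T + (c + j₁ / T) = ((a + j₁ + c * T : ℤ) : ℚ) / T := by
    push_cast
    field_simp
    ring
  have hshift : a - j₂ + b * T - r = a + j₁ + c * T + (b - c + k) * T := by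
    linear_combination -hrk
  rw [hy, hz, lam_intCast_div T _ r (Int.emod_nonneg _ hTz.ne') (Int.emod_lt_of_pos _ hTz),
    Rat.floor_intCast_div_natCast, hshift, Int.add_mul_ediv_right _ _ hTz.ne']
  push_cast
  field_simp
  linear_combination hrkQ
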